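/- arXiv:2603.15671 — 7 statements merged into one kernel-verified Lean document; each statement's English description precedes it below -/
import Mathlib

section
/- Let η be a sigmoidal function satisfying (P1)–(P3) and η(1) < 1, and let σ_η(s) := (η(s+1) - η(s-1))/2. Then for every s ∈ ℝ the series ∑_{k∈ℤ} σ_η(s-k) converges and equals 1. -/
open Filter Asymptotics MeasureTheory

/-- The activation function `σ_η(s) = (η(s+1) - η(s-1))/2`. -/
noncomputable def act (η : ℝ → ℝ) (s : ℝ) : ℝ := (η (s + 1) - η (s - 1)) / 2

theorem act_hasSum_one
    (η : ℝ → ℝ)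
    (hmono : Monotone η)
    (hmeas : Measurable η)
    (hbot : Tendsto η atBot (nhds 0))
    (htop : Tendsto η atTop (nhds 1))
    (hη1 : η 1 < 1)
    (hP1 : ∀ s : ℝ, η (-s) - 1 / 2 = -(η s - 1 / 2))
    (hP2 : ContDiff ℝ 2 η)
    (hP2' : ConcaveOn ℝ (Set.Ici 0) η)
    (hP3 : ∃ ρ : ℝ, 0 < ρ ∧ η =O[atBot] fun s : ℝ => |s| ^ (-1 - ρ)) :
    ∀ s : ℝ, HasSum (fun k : ℤ => act η (s - (k : ℝ))) 1 := by
  intro s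
  have hnn : ∀ x, 0 ≤ act η x := fun x => by
    have := hmono (show x - 1 ≤ x + 1 by linarith)
    unfold act
    linarith
  have h1 : HasSum (fun n : ℕ => act η (s - ((n : ℤ) : ℝ))) ((η (s + 1) + η s) / 2) := by
    rw [hasSum_iff_tendsto_nat_of_nonneg (fun n => hnn _)]
    have hs : ∀ N : ℕ, ∑ i ∈ Finset.range N, act η (s - ((i : ℤ) : ℝ))
        = (η (s + 1) + η s) / 2 - (η (-(N : ℝ) + (s + 1)) + η (-(N : ℝ) + s)) / 2 := by
      intro N
      induction N with
      | zero => simp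
      | succ n ih =>
        rw [Finset.sum_range_succ, ih]
        unfold act
        push_cast
        rw [show s - (n : ℝ) + 1 = -(n : ℝ) + (s + 1) by ring,
          show -((n : ℝ) + 1) + (s + 1) = -(n : ℝ) + s by ring,
          show s - (n : ℝ) - 1 = -((n : ℝ) + 1) + s by ring]
        ring
    simp_rw [hs]
    have hl : ∀ c : ℝ, Tendsto (fun N : ℕ => η (-(N : ℝ) + c)) atTop (nhds 0) := fun c =>
      hbot.comp (tendsto_atBot_add_const_right _ c
        (tendsto_neg_atTop_atBot.comp tendsto_natCast_atTop_atTop))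
    have := (((hl (s + 1)).add (hl s)).div_const 2).const_sub ((η (s + 1) + η s) / 2)
    simpa using this
  have h2 : HasSum (fun n : ℕ => act η (s - ((-((n : ℤ) + 1) : ℤ) : ℝ)))
      (1 - (η (s + 1) + η s) / 2) := by
    rw [hasSum_iff_tendsto_nat_of_nonneg (fun n => hnn _)]
    have hs : ∀ N : ℕ, ∑ i ∈ Finset.range N, act η (s - ((-((i : ℤ) + 1) : ℤ) : ℝ))
        = (η ((N : ℝ) + (s + 1)) + η ((N : ℝ) + s)) / 2 - (η (s + 1) + η s) / 2 := by
      intro N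
      induction N with
      | zero => simp
      | succ n ih =>
        rw [Finset.sum_range_succ, ih]
        unfold act
        push_cast
        rw [show s - -((n : ℝ) + 1) + 1 = (n : ℝ) + 1 + (s + 1) by ring,
          show (n : ℝ) + 1 + s = (n : ℝ) + (s + 1) by ring,
          show s - -((n : ℝ) + 1) - 1 = (n : ℝ) + s by ring]
        ring
    simp_rw [hs]
    have hl : ∀ c : ℝ, Tendsto (fun N : ℕ => η ((N : ℝ) + c)) atTop (nhds 1) := fun c =>
      htop.comp (tendsto_atTop_add_const_right _ c tendsto_natCast_atTop_atTop)
    have := (((hl (s + 1)).add (hl s)).div_const 2).sub_const ((η (s + 1) + η s) / 2)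
    norm_num at this
    exact this
  have h := HasSum.of_nat_of_neg_add_one (f := fun k : ℤ => act η (s - (k : ℝ))) h1 h2
  simpa using h
end

section
/- Let η be a sigmoidal function satisfying (P1)–(P3) and η(1) < 1, and let σ_η(s) := (η(s+1) - η(s-1))/2. Then σ_η is Lebesgue integrable on ℝ and ∫_ℝ σ_η(s) ds = 1. -/
open Filter Asymptotics MeasureTheory

theorem act_integrable_integral_one
    (η : ℝ → ℝ)
    (hmono : Monotone η)
    (hmeas : Measurable η)
    (hbot : Tendsto η atBot (nhds 0))
    (htop : Tendsto η atTop (nhds 1))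
    (hη1 : η 1 < 1)
    (hP1 : ∀ s : ℝ, η (-s) - 1 / 2 = -(η s - 1 / 2))
    (hP2 : ContDiff ℝ 2 η)
    (hP2' : ConcaveOn ℝ (Set.Ici 0) η)
    (hP3 : ∃ ρ : ℝ, 0 < ρ ∧ η =O[atBot] fun s : ℝ => |s| ^ (-1 - ρ)) :
    Integrable (act η) ∧ ∫ s : ℝ, act η s = 1 := by
  have hc : Continuous η := hP2.continuous
  have hii : ∀ a b : ℝ, IntervalIntegrable η volume a b := fun a b => hc.intervalIntegrable a b
  have hact : Continuous (act η) := by unfold act; fun_prop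
  have hnn : ∀ s, 0 ≤ act η s := fun s => by
    have := hmono (show s - 1 ≤ s + 1 by linarith)
    unfold act; linarith
  set F : ℝ → ℝ := fun x => ∫ t in (0:ℝ)..x, η t with hF
  have hFd : ∀ x, HasDerivAt F (η x) x := fun x =>
    intervalIntegral.integral_hasDerivAt_right (hii 0 x)
      (hc.stronglyMeasurableAtFilter _ _) hc.continuousAt
  set G : ℝ → ℝ := fun x => (F (x + 1) - F (x - 1)) / 2 with hG
  have hGd : ∀ x, HasDerivAt G (act η x) x := fun x =>
    (((hFd (x + 1)).comp_add_const x 1).sub ((hFd (x - 1)).comp_sub_const x 1)).div_const 2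
  have hGe : ∀ x, G x = (∫ t in (x - 1)..(x + 1), η t) / 2 := fun x => by
    simp only [hG, hF]
    rw [intervalIntegral.integral_interval_sub_left (hii _ _) (hii _ _)]
  have hlo : ∀ x, η (x - 1) ≤ G x := fun x => by
    have h := intervalIntegral.integral_mono_on (a := x - 1) (b := x + 1) (μ := volume)
      (f := fun _ => η (x - 1)) (g := η) (by linarith) (by simp) (hii _ _)
      (fun t ht => hmono ht.1)
    rw [intervalIntegral.integral_const, smul_eq_mul] at h
    rw [hGe]; linarith
  have hhi : ∀ x, G x ≤ η (x + 1) := fun x => by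
    have h := intervalIntegral.integral_mono_on (a := x - 1) (b := x + 1) (μ := volume)
      (f := η) (g := fun _ => η (x + 1)) (by linarith) (hii _ _) (by simp)
      (fun t ht => hmono ht.2)
    rw [intervalIntegral.integral_const, smul_eq_mul] at h
    rw [hGe]; linarith
  have hGt : Tendsto G atTop (nhds 1) :=
    tendsto_of_tendsto_of_tendsto_of_le_of_le
      (htop.comp (tendsto_atTop_add_const_right _ (-1) tendsto_id))
      (htop.comp (tendsto_atTop_add_const_right _ 1 tendsto_id)) hlo hhi
  have hGb : Tendsto G atBot (nhds 0) :=
    tendsto_of_tendsto_of_tendsto_of_le_of_le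
      (hbot.comp (tendsto_atBot_add_const_right _ (-1) tendsto_id))
      (hbot.comp (tendsto_atBot_add_const_right _ 1 tendsto_id)) hlo hhi
  have hint : ∀ x : ℝ, ∫ t in (-x)..x, act η t = G x - G (-x) := fun x =>
    intervalIntegral.integral_eq_sub_of_hasDerivAt (fun t _ => hGd t)
      (hact.intervalIntegrable _ _)
  have hlim : Tendsto (fun x : ℝ => ∫ t in (-x)..x, act η t) atTop (nhds 1) := by
    simp only [hint]
    simpa using hGt.sub (hGb.comp tendsto_neg_atTop_atBot)
  have hI : Integrable (act η) := by
    refine integrable_of_intervalIntegral_norm_tendsto (l := atTop) (a := fun x : ℝ => -x)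
      (b := fun x => x) 1 (fun x => ?_) tendsto_neg_atTop_atBot tendsto_id ?_
    · exact (hact.integrableOn_Icc).mono_set Set.Ioc_subset_Icc_self
    · simpa only [Real.norm_of_nonneg (hnn _)] using hlim
  exact ⟨hI, tendsto_nhds_unique
    (intervalIntegral_tendsto_integral hI tendsto_neg_atTop_atBot tendsto_id) hlim⟩
end

section
/- Let η be a sigmoidal function satisfying (P1)–(P3) and η(1) < 1, and let σ_η(s) := (η(s+1) - η(s-1))/2. Then for every δ > 0, the quantity sup_{s∈ℝ} ∑_{k∈ℤ, |ns-k| > nδ} σ_η(ns-k) tends to 0 as n → ∞ (localization property). -/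
open Filter Asymptotics MeasureTheory

theorem act_sum_range_aux (η : ℝ → ℝ) (y : ℝ) (N : ℕ) :
    ∑ j ∈ Finset.range N, act η (y + (j : ℝ)) =
      (η (y + N) + η (y + N - 1) - η y - η (y - 1)) / 2 := by
  induction N with
  | zero => simp
  | succ N ih =>
    rw [Finset.sum_range_succ, ih]
    unfold act
    push_cast
    have h1 : y + ((N : ℝ) + 1) = y + N + 1 := by ring
    have h2 : y + (N : ℝ) + 1 - 1 = y + N := by ring
    rw [h1, h2]
    ring

theorem act_nonneg_aux (η : ℝ → ℝ) (hmono : Monotone η) (s : ℝ) : 0 ≤ act η s := by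
  have := hmono (show s - 1 ≤ s + 1 by linarith)
  unfold act
  linarith

theorem act_sum_int_aux (η : ℝ → ℝ) (hmono : Monotone η) (hle : ∀ s, η s ≤ 1) (R y : ℝ)
    (G : Finset ℤ) (hG : ∀ k ∈ G, R < y + (k : ℝ)) :
    ∑ k ∈ G, act η (y + (k : ℝ)) ≤ 1 - η (R - 1) := by
  set m : ℤ := ⌊R - y⌋ + 1 with hm
  have hmR : R - y < (m : ℝ) := by
    rw [hm]; push_cast; exact Int.lt_floor_add_one _
  obtain ⟨M, hM⟩ := G.bddAbove
  have hsub : G ⊆ (Finset.range (M - m + 1).toNat).image (fun j : ℕ => m + (j : ℤ)) := by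
    intro k hk
    have h1 : m ≤ k := by
      rw [hm, Int.add_one_le_iff, Int.floor_lt]
      linarith [hG k hk]
    have h2 : k ≤ M := hM hk
    rw [Finset.mem_image]
    exact ⟨(k - m).toNat, by rw [Finset.mem_range]; omega, by omega⟩
  calc ∑ k ∈ G, act η (y + (k : ℝ))
      ≤ ∑ k ∈ (Finset.range (M - m + 1).toNat).image (fun j : ℕ => m + (j : ℤ)),
          act η (y + (k : ℝ)) :=
        Finset.sum_le_sum_of_subset_of_nonneg hsub
          (fun _ _ _ => act_nonneg_aux η hmono _)
    _ = ∑ j ∈ Finset.range (M - m + 1).toNat, act η ((y + m) + (j : ℝ)) := by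
        rw [Finset.sum_image (by intro a _ b _ h; simpa using h)]
        refine Finset.sum_congr rfl fun j _ => ?_
        push_cast
        rw [add_assoc]
    _ ≤ 1 - η (R - 1) := by
        rw [act_sum_range_aux]
        have a := hle (y + m + ((M - m + 1).toNat : ℝ))
        have b := hle (y + m + ((M - m + 1).toNat : ℝ) - 1)
        have c := hmono (show R - 1 ≤ y + m by linarith)
        have d := hmono (show R - 1 ≤ y + m - 1 by linarith)
        linarith

theorem act_even_aux (η : ℝ → ℝ) (hP1 : ∀ s : ℝ, η (-s) - 1 / 2 = -(η s - 1 / 2)) (s : ℝ) :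
    act η (-s) = act η s := by
  have h1 := hP1 (s + 1)
  have h2 := hP1 (s - 1)
  unfold act
  rw [show -s + 1 = -(s - 1) by ring, show -s - 1 = -(s + 1) by ring]
  linarith

theorem act_sum_abs_aux (η : ℝ → ℝ) (hmono : Monotone η) (hle : ∀ s, η s ≤ 1)
    (hP1 : ∀ s : ℝ, η (-s) - 1 / 2 = -(η s - 1 / 2)) (R x : ℝ)
    (G : Finset ℤ) (hG : ∀ k ∈ G, R < |x - (k : ℝ)|) :
    ∑ k ∈ G, act η (x - (k : ℝ)) ≤ 2 * (1 - η (R - 1)) := by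
  rw [← Finset.sum_filter_add_sum_filter_not G (fun k : ℤ => (k : ℝ) ≤ x)]
  have h1 : ∑ k ∈ G.filter (fun k : ℤ => (k : ℝ) ≤ x), act η (x - (k : ℝ)) ≤ 1 - η (R - 1) := by
    have := act_sum_int_aux η hmono hle R x ((G.filter (fun k : ℤ => (k : ℝ) ≤ x)).image (-·)) ?_
    · rw [Finset.sum_image (by intro a _ b _ h; simpa using h)] at this
      refine le_trans (le_of_eq (Finset.sum_congr rfl fun k _ => ?_)) this
      push_cast
      rw [sub_eq_add_neg]
    · intro k hk
      obtain ⟨l, hl, rfl⟩ := Finset.mem_image.1 hk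
      obtain ⟨hl1, hl2⟩ := Finset.mem_filter.1 hl
      have := hG l hl1
      rw [abs_of_nonneg (by linarith)] at this
      push_cast
      linarith
  have h2 : ∑ k ∈ G.filter (fun k : ℤ => ¬ (k : ℝ) ≤ x), act η (x - (k : ℝ)) ≤ 1 - η (R - 1) := by
    have := act_sum_int_aux η hmono hle R (-x) (G.filter (fun k : ℤ => ¬ (k : ℝ) ≤ x)) ?_
    · refine le_trans (le_of_eq (Finset.sum_congr rfl fun k _ => ?_)) this
      rw [← act_even_aux η hP1]
      congr 1
      ring
    · intro l hl
      obtain ⟨hl1, hl2⟩ := Finset.mem_filter.1 hl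
      have := hG l hl1
      rw [abs_of_neg (by linarith)] at this
      linarith
  linarith

theorem act_localization
    (η : ℝ → ℝ)
    (hmono : Monotone η)
    (hmeas : Measurable η)
    (hbot : Tendsto η atBot (nhds 0))
    (htop : Tendsto η atTop (nhds 1))
    (hη1 : η 1 < 1)
    (hP1 : ∀ s : ℝ, η (-s) - 1 / 2 = -(η s - 1 / 2))
    (hP2 : ContDiff ℝ 2 η)
    (hP2' : ConcaveOn ℝ (Set.Ici 0) η)
    (hP3 : ∃ ρ : ℝ, 0 < ρ ∧ η =O[atBot] fun s : ℝ => |s| ^ (-1 - ρ)) :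
    ∀ δ : ℝ, 0 < δ →
      Tendsto (fun n : ℕ => ⨆ s : ℝ,
          ∑' k : {k : ℤ // (n : ℝ) * δ < |(n : ℝ) * s - (k : ℝ)|},
            act η ((n : ℝ) * s - ((k : ℤ) : ℝ))) atTop (nhds 0) := by
  intro δ hδ
  have hle : ∀ s, η s ≤ 1 := fun s => hmono.ge_of_tendsto htop s
  have hlim : Tendsto (fun n : ℕ => 2 * (1 - η ((n : ℝ) * δ - 1))) atTop (nhds 0) := by
    have h1 : Tendsto (fun n : ℕ => (n : ℝ) * δ - 1) atTop atTop :=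
      tendsto_atTop_add_const_right _ _
        (tendsto_natCast_atTop_atTop.atTop_mul_const hδ)
    have h2 := ((htop.comp h1).const_sub 1).const_mul 2
    simpa using h2
  refine squeeze_zero (fun n => ?_) (fun n => ?_) hlim
  · exact Real.iSup_nonneg fun s => tsum_nonneg fun k => act_nonneg_aux η hmono _
  · have h0 : 0 ≤ 2 * (1 - η ((n : ℝ) * δ - 1)) := by linarith [hle ((n : ℝ) * δ - 1)]
    refine Real.iSup_le (fun s => ?_) h0
    refine Real.tsum_le_of_sum_le (fun k => act_nonneg_aux η hmono _) (fun F => ?_)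
    have := act_sum_abs_aux η hmono hle hP1 ((n : ℝ) * δ) ((n : ℝ) * s)
      (F.map (Function.Embedding.subtype _)) ?_
    · rw [Finset.sum_map] at this
      exact this
    · intro k hk
      obtain ⟨l, _, rfl⟩ := Finset.mem_map.1 hk
      exact l.2
end

section
/- Let η be a sigmoidal function satisfying (P1)–(P3) and η(1) < 1, and let σ_η(s) := (η(s+1) - η(s-1))/2. Then the series of functions s ↦ ∑_{k∈ℤ} σ_η(s-k) converges uniformly on every compact subset of ℝ; that is, the partial sums ∑_{|k|≤N} σ_η(s-k) converge uniformly on compacts to the sum function as N → ∞. -/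
open Filter Asymptotics MeasureTheory

lemma act_partial (η : ℝ → ℝ) (s : ℝ) (N : ℕ) :
    ∑ k ∈ Finset.Icc (-(N : ℤ)) (N : ℤ), act η (s - (k : ℝ)) =
      (η (s + N + 1) + η (s + N) - η (s - N) - η (s - N - 1)) / 2 := by
  induction N with
  | zero => simp [act]
  | succ n ih =>
    have h : Finset.Icc (-((n + 1 : ℕ) : ℤ)) ((n + 1 : ℕ) : ℤ) =
        insert (-((n : ℤ) + 1)) (insert ((n : ℤ) + 1) (Finset.Icc (-(n : ℤ)) (n : ℤ))) := by
      ext x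
      simp only [Finset.mem_Icc, Finset.mem_insert]
      push_cast
      omega
    rw [h, Finset.sum_insert, Finset.sum_insert, ih]
    · simp only [act]
      push_cast
      have e1 : s - -((n : ℝ) + 1) + 1 = s + (n + 1) + 1 := by ring
      have e2 : s - -((n : ℝ) + 1) - 1 = s + n := by ring
      have e3 : s - ((n : ℝ) + 1) + 1 = s - n := by ring
      have e4 : s + (n : ℝ) + 1 = s + (n + 1) := by ring
      have e5 : s - (n : ℝ) - 1 = s - (n + 1) := by ring
      rw [e1, e2, e3, e4, e5]
      ring
    · simp
    · simp only [Finset.mem_Icc, Finset.mem_insert]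
      omega

lemma act_bounds (η : ℝ → ℝ) (hmono : Monotone η)
    (h0 : ∀ x, 0 ≤ η x) (h1 : ∀ x, η x ≤ 1) (R s : ℝ) (hs : |s| ≤ R) (N : ℕ) :
    η (N - R) - η (R - N) ≤ ∑ k ∈ Finset.Icc (-(N : ℤ)) (N : ℤ), act η (s - (k : ℝ)) ∧
    ∑ k ∈ Finset.Icc (-(N : ℤ)) (N : ℤ), act η (s - (k : ℝ)) ≤ 1 := by
  rw [act_partial]
  obtain ⟨ha, hb⟩ := abs_le.1 hs
  have a1 : η (N - R) ≤ η (s + N + 1) := hmono (by linarith)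
  have a2 : η (N - R) ≤ η (s + N) := hmono (by linarith)
  have a3 : η (s - N) ≤ η (R - N) := hmono (by linarith)
  have a4 : η (s - N - 1) ≤ η (R - N) := hmono (by linarith)
  constructor
  · linarith
  · linarith [h1 (s + N + 1), h1 (s + N), h0 (s - N), h0 (s - N - 1)]

theorem act_sum_tendstoUniformlyOn_compacts
    (η : ℝ → ℝ)
    (hmono : Monotone η)
    (hmeas : Measurable η)
    (hbot : Tendsto η atBot (nhds 0))
    (htop : Tendsto η atTop (nhds 1))
    (hη1 : η 1 < 1)
    (hP1 : ∀ s : ℝ, η (-s) - 1 / 2 = -(η s - 1 / 2))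
    (hP2 : ContDiff ℝ 2 η)
    (hP2' : ConcaveOn ℝ (Set.Ici 0) η)
    (hP3 : ∃ ρ : ℝ, 0 < ρ ∧ η =O[atBot] fun s : ℝ => |s| ^ (-1 - ρ)) :
    ∀ K : Set ℝ, IsCompact K →
      TendstoUniformlyOn
        (fun (N : ℕ) (s : ℝ) => ∑ k ∈ Finset.Icc (-(N : ℤ)) (N : ℤ), act η (s - (k : ℝ)))
        (fun s : ℝ => ∑' k : ℤ, act η (s - (k : ℝ))) atTop K := by
  intro K hK
  have h0 : ∀ x, 0 ≤ η x := fun x => hmono.le_of_tendsto hbot x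
  have h1 : ∀ x, η x ≤ 1 := fun x => hmono.ge_of_tendsto htop x
  have hlow : ∀ R : ℝ, Tendsto (fun N : ℕ => η (N - R) - η (R - N)) atTop (nhds 1) := by
    intro R
    have t : Tendsto (fun N : ℕ => (N : ℝ) - R) atTop atTop :=
      tendsto_atTop_add_const_right _ (-R) tendsto_natCast_atTop_atTop
    have t2 : Tendsto (fun N : ℕ => R - (N : ℝ)) atTop atBot := by
      have := tendsto_neg_atTop_atBot.comp t
      refine this.congr fun N => ?_
      simp
    simpa using (htop.comp t).sub (hbot.comp t2)
  have hlim : ∀ s : ℝ, Tendsto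
      (fun N : ℕ => ∑ k ∈ Finset.Icc (-(N : ℤ)) (N : ℤ), act η (s - (k : ℝ))) atTop (nhds 1) :=
    fun s => tendsto_of_tendsto_of_tendsto_of_le_of_le (hlow |s|) tendsto_const_nhds
      (fun N => (act_bounds η hmono h0 h1 _ s le_rfl N).1)
      (fun N => (act_bounds η hmono h0 h1 _ s le_rfl N).2)
  have hnn : ∀ s, 0 ≤ act η s := fun s => by
    have : η (s - 1) ≤ η (s + 1) := hmono (by linarith)
    unfold act
    linarith
  have htsum : ∀ s : ℝ, ∑' k : ℤ, act η (s - (k : ℝ)) = 1 := by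
    intro s
    have hIcc : Tendsto (fun N : ℕ => Finset.Icc (-(N : ℤ)) (N : ℤ)) atTop atTop := by
      refine tendsto_atTop_finset_of_monotone ?_ ?_
      · intro a b hab
        exact Finset.Icc_subset_Icc (by omega) (by omega)
      · intro x
        exact ⟨x.natAbs, by rw [Finset.mem_Icc]; omega⟩
    have hsum : Summable fun k : ℤ => act η (s - (k : ℝ)) := by
      refine summable_of_sum_le (c := 1) (fun k => hnn _) fun u => ?_
      obtain ⟨N, hN⟩ := (hIcc.eventually_ge_atTop u).exists
      exact (Finset.sum_le_sum_of_subset_of_nonneg hN fun _ _ _ => hnn _).trans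
        (act_bounds η hmono h0 h1 _ s le_rfl N).2
    exact tendsto_nhds_unique (hsum.hasSum.comp hIcc) (hlim s)
  obtain ⟨R, hR⟩ := hK.isBounded.exists_norm_le
  rw [Metric.tendstoUniformlyOn_iff]
  intro ε hε
  filter_upwards [(hlow R).eventually_const_lt (show 1 - ε < 1 by linarith)] with N hN s hs
  have hb := act_bounds η hmono h0 h1 R s (by simpa using hR s hs) N
  rw [htsum s, Real.dist_eq, abs_lt]
  constructor <;> linarith [hb.1, hb.2]
end

section
/- Let η be a sigmoidal function satisfying (P1)–(P3) with decay exponent ρ > 0 and η(1) < 1, and let σ_η(s) := (η(s+1) - η(s-1))/2. Then for every r with 0 ≤ r < ρ, the discrete absolute moment of order r is finite: M_r(σ_η) := sup_{s∈ℝ} ∑_{k∈ℤ} |σ_η(s-k)|·|s-k|^r < +∞. -/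
open Filter Asymptotics MeasureTheory

theorem act_bound
    (η : ℝ → ℝ)
    (hmono : Monotone η)
    (hbot : Tendsto η atBot (nhds 0))
    (htop : Tendsto η atTop (nhds 1))
    (hP1 : ∀ s : ℝ, η (-s) - 1 / 2 = -(η s - 1 / 2))
    (ρ : ℝ) (hρ : 0 < ρ)
    (hP3 : η =O[atBot] fun s : ℝ => |s| ^ (-1 - ρ)) :
    ∃ C : ℝ, 0 ≤ C ∧ ∀ x, |act η x| ≤ C * (2 + |x|) ^ (-1 - ρ) := by
  have h0 : ∀ x, 0 ≤ η x := fun x => hmono.le_of_tendsto hbot x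
  have h1 : ∀ x, η x ≤ 1 := fun x => hmono.ge_of_tendsto htop x
  have hact : ∀ x, |act η x| ≤ η (1 - |x|) := by
    intro x
    have hm : η (x - 1) ≤ η (x + 1) := hmono (by linarith)
    unfold act
    rw [abs_of_nonneg (by linarith)]
    rcases le_total 0 x with hx | hx
    · rw [abs_of_nonneg hx]
      have e1 := hP1 (x - 1)
      rw [neg_sub] at e1
      have := h1 (x + 1)
      have := h0 (1 - x)
      linarith
    · rw [abs_of_nonpos hx, sub_neg_eq_add, add_comm 1 x]
      have := h0 (x - 1)
      have := h0 (x + 1)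
      linarith
  obtain ⟨C0, hC0, hb⟩ := hP3.exists_pos
  obtain ⟨A, hA⟩ := eventually_atBot.1 hb.bound
  set B : ℝ := |A| + 2 with hB
  have hB0 : 0 ≤ |A| := abs_nonneg A
  refine ⟨C0 * 4 ^ (1 + ρ) + (2 + B) ^ (1 + ρ), by positivity, fun x => ?_⟩
  have hx0 := abs_nonneg x
  have hp : 0 < 2 + |x| := by linarith
  refine (hact x).trans ?_
  rcases le_total B |x| with hx | hx
  · have h2 := hA (1 - |x|) (by have := neg_abs_le A; linarith)
    rw [Real.norm_of_nonneg (h0 _), Real.norm_of_nonneg (by positivity)] at h2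
    refine h2.trans ?_
    have h3 : |(1 - |x|)| = |x| - 1 := by rw [abs_of_nonpos (by linarith)]; ring
    have h4 : |(1 - |x|)| ^ (-1 - ρ) ≤ ((2 + |x|) / 4) ^ (-1 - ρ) := by
      rw [h3]
      exact Real.rpow_le_rpow_of_nonpos (by positivity) (by linarith) (by linarith)
    have h5 : ((2 + |x|) / 4) ^ (-1 - ρ) = 4 ^ (1 + ρ) * (2 + |x|) ^ (-1 - ρ) := by
      rw [Real.div_rpow hp.le (by norm_num), show -1 - ρ = -(1 + ρ) by ring,
        Real.rpow_neg (by norm_num : (0:ℝ) ≤ 4)]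
      field_simp
    rw [h5] at h4
    have h6 : 0 ≤ (2 + B) ^ (1 + ρ) * (2 + |x|) ^ (-1 - ρ) := by positivity
    have h7 := mul_le_mul_of_nonneg_left h4 hC0.le
    linarith
  · have h2 : 1 ≤ (2 + B) ^ (1 + ρ) * (2 + |x|) ^ (-1 - ρ) := by
      have h3 : (2 + |x|) ^ (1 + ρ) ≤ (2 + B) ^ (1 + ρ) :=
        Real.rpow_le_rpow hp.le (by linarith) (by linarith)
      rw [show -1 - ρ = -(1 + ρ) by ring, Real.rpow_neg hp.le, ← div_eq_mul_inv,
        le_div_iff₀ (by positivity)]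
      linarith
    have h6 : 0 ≤ C0 * 4 ^ (1 + ρ) * (2 + |x|) ^ (-1 - ρ) := by positivity
    have := h1 (1 - |x|)
    linarith

theorem act_moment_finite
    (η : ℝ → ℝ)
    (hmono : Monotone η)
    (hmeas : Measurable η)
    (hbot : Tendsto η atBot (nhds 0))
    (htop : Tendsto η atTop (nhds 1))
    (hη1 : η 1 < 1)
    (hP1 : ∀ s : ℝ, η (-s) - 1 / 2 = -(η s - 1 / 2))
    (hP2 : ContDiff ℝ 2 η)
    (hP2' : ConcaveOn ℝ (Set.Ici 0) η)
    (ρ : ℝ) (hρ : 0 < ρ)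
    (hP3 : η =O[atBot] fun s : ℝ => |s| ^ (-1 - ρ)) :
    ∀ r : ℝ, 0 ≤ r → r < ρ →
      (⨆ s : ℝ, ∑' k : ℤ, ENNReal.ofReal (|act η (s - (k : ℝ))| * |s - (k : ℝ)| ^ r)) < ⊤ := by
  intro r hr hrρ
  obtain ⟨C, hC, hb⟩ := act_bound η hmono hbot htop hP1 ρ hρ hP3
  have hg : ∀ x, |act η x| * |x| ^ r ≤ C * (2 + |x|) ^ (-(1 + ρ - r)) := by
    intro x
    have hx0 := abs_nonneg x
    have hp : 0 < 2 + |x| := by linarith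
    calc |act η x| * |x| ^ r ≤ (C * (2 + |x|) ^ (-1 - ρ)) * (2 + |x|) ^ r :=
          mul_le_mul (hb x) (Real.rpow_le_rpow hx0 (by linarith) hr) (by positivity)
            (by positivity)
      _ = _ := by
          rw [mul_assoc, ← Real.rpow_add hp]
          congr 2
          ring
  let F : ℤ → ℝ := fun j => C * (|(j : ℝ)| ^ (-(1 + ρ - r)) + if j = 0 then 1 else 0)
  have hF : Summable F :=
    ((Real.summable_abs_int_rpow (by linarith)).add (hasSum_ite_eq 0 1).summable).mul_left C
  have hle : ∀ s : ℝ, ∑' k : ℤ, ENNReal.ofReal (|act η (s - (k : ℝ))| * |s - (k : ℝ)| ^ r)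
      ≤ ∑' j : ℤ, ENNReal.ofReal (F j) := by
    intro s
    rw [← (Equiv.subLeft ⌊s⌋).tsum_eq
      (fun k : ℤ => ENNReal.ofReal (|act η (s - (k : ℝ))| * |s - (k : ℝ)| ^ r))]
    refine ENNReal.tsum_le_tsum fun j => ENNReal.ofReal_le_ofReal ?_
    refine (hg _).trans (mul_le_mul_of_nonneg_left ?_ hC)
    have hx : s - (((Equiv.subLeft ⌊s⌋) j : ℤ) : ℝ) = Int.fract s + j := by
      simp only [Equiv.subLeft_apply, Int.cast_sub, Int.fract]
      ring
    rw [hx]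
    have f0 := Int.fract_nonneg s
    have f1 := Int.fract_lt_one s
    have hx0 := abs_nonneg (Int.fract s + j)
    by_cases hj : j = 0
    · rw [if_pos hj]
      have : (2 + |Int.fract s + j|) ^ (-(1 + ρ - r)) ≤ 1 :=
        Real.rpow_le_one_of_one_le_of_nonpos (by linarith) (by linarith)
      have : 0 ≤ |(j : ℝ)| ^ (-(1 + ρ - r)) := by positivity
      linarith
    · rw [if_neg hj, add_zero]
      have hj' : (j : ℝ) ≠ 0 := by exact_mod_cast hj
      refine Real.rpow_le_rpow_of_nonpos (abs_pos.2 hj') ?_ (by linarith)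
      have h := abs_sub (Int.fract s + j) (Int.fract s)
      rw [add_sub_cancel_left, abs_of_nonneg f0] at h
      linarith
  exact (iSup_le hle).trans_lt hF.tsum_ofReal_lt_top
end

section
/- Let η be a sigmoidal function satisfying (P1)–(P3) and η(1) < 1, and let σ_η(s) := (η(s+1) - η(s-1))/2. Then the discrete absolute moment of order 0 is finite: M_0(σ_η) := sup_{s∈ℝ} ∑_{k∈ℤ} σ_η(s-k) < +∞. -/
open Filter Asymptotics MeasureTheory

theorem act_sum_range (η : ℝ → ℝ) (t : ℝ) (m : ℕ) :
    ∑ n ∈ Finset.range m, act η (t + n) =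
      (η (t + m) + η (t + m - 1) - η t - η (t - 1)) / 2 := by
  induction m with
  | zero => simp
  | succ m ih =>
    rw [Finset.sum_range_succ, ih]
    unfold act
    push_cast
    have h1 : t + ((m : ℝ) + 1) = t + m + 1 := by ring
    have h2 : t + (m : ℝ) + 1 - 1 = t + m := by ring
    rw [h1, h2]
    ring

theorem act_moment_zero_finite
    (η : ℝ → ℝ)
    (hmono : Monotone η)
    (hmeas : Measurable η)
    (hbot : Tendsto η atBot (nhds 0))
    (htop : Tendsto η atTop (nhds 1))
    (hη1 : η 1 < 1)
    (hP1 : ∀ s : ℝ, η (-s) - 1 / 2 = -(η s - 1 / 2))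
    (hP2 : ContDiff ℝ 2 η)
    (hP2' : ConcaveOn ℝ (Set.Ici 0) η)
    (hP3 : ∃ ρ : ℝ, 0 < ρ ∧ η =O[atBot] fun s : ℝ => |s| ^ (-1 - ρ)) :
    (⨆ s : ℝ, ∑' k : ℤ, ENNReal.ofReal (act η (s - (k : ℝ)))) < ⊤ := by
  have h0 : ∀ x, 0 ≤ η x := fun x => hmono.le_of_tendsto hbot x
  have h1 : ∀ x, η x ≤ 1 := fun x => hmono.ge_of_tendsto htop x
  have hact : ∀ x, 0 ≤ act η x := fun x => by
    have := hmono (show x - 1 ≤ x + 1 by linarith)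
    unfold act
    linarith
  refine lt_of_le_of_lt (b := 1) (iSup_le fun s => ?_) ENNReal.one_lt_top
  rw [ENNReal.tsum_eq_iSup_sum]
  refine iSup_le fun F => ?_
  rw [← ENNReal.ofReal_sum_of_nonneg (fun k _ => hact _)]
  rw [ENNReal.ofReal_le_one]
  obtain ⟨N, hN⟩ := F.bddAbove
  obtain ⟨M, hM⟩ := F.bddBelow
  have hsub : F ⊆ (Finset.range (N - M + 1).toNat).image (fun n : ℕ => N - (n : ℤ)) := by
    intro k hk
    have hk1 : k ≤ N := hN hk
    have hk2 : M ≤ k := hM hk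
    rw [Finset.mem_image]
    exact ⟨(N - k).toNat, by rw [Finset.mem_range]; omega, by omega⟩
  refine (Finset.sum_le_sum_of_subset_of_nonneg hsub (fun k _ _ => hact _)).trans ?_
  rw [Finset.sum_image (fun a _ b _ h => by simpa using h)]
  have h2 := act_sum_range η (s - N) (N - M + 1).toNat
  have h3 : ∀ n : ℕ, s - ((N - (n : ℤ) : ℤ) : ℝ) = s - N + n := fun n => by
    push_cast
    ring
  simp only [h3]
  rw [h2]
  linarith [h1 (s - N + (N - M + 1).toNat), h1 (s - N + (N - M + 1).toNat - 1),
    h0 (s - N), h0 (s - N - 1)]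
end

section
/- Let η be a sigmoidal function satisfying (P1)–(P3) and η(1) < 1, let σ_η(s) := (η(s+1) - η(s-1))/2, and for d ≥ 1 let σ(s) := ∏_{i=1}^d σ_η(s_i). Let K = ∏_{i=1}^d [a_i, b_i] with a_i < b_i, let 0 ≤ α ≤ β, and let f : ℝ^d → ℝ be bounded and continuous. Then the Stancu-type operators converge uniformly to f on K: sup_{s∈K} |F_n^{(α,β)}(f; s) - f(s)| → 0 as n → ∞. -/
open Filter Asymptotics MeasureTheory

/-- The multivariate activation `σ(s) = ∏ i, σ_η(s i)`. -/
noncomputable def actM (η : ℝ → ℝ) {d : ℕ} (s : Fin d → ℝ) : ℝ := ∏ i, act η (s i)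

/-- The index set `Λ_n = {k : ℤ^d | ⌈n aᵢ⌉ ≤ kᵢ ≤ ⌊n bᵢ⌋}`. -/
noncomputable def Lam {d : ℕ} (a b : Fin d → ℝ) (n : ℕ) : Finset (Fin d → ℤ) :=
  Fintype.piFinset fun i => Finset.Icc ⌈(n : ℝ) * a i⌉ ⌊(n : ℝ) * b i⌋

/-- Interpret a vector of coordinates as a point of Euclidean space. -/
noncomputable def toEuc {d : ℕ} (x : Fin d → ℝ) : EuclideanSpace ℝ (Fin d) :=
  (WithLp.equiv 2 (Fin d → ℝ)).symm x

/-- The multivariate Stancu-type neural network operator `F_n^{(α,β)}(f; s)`. -/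
noncomputable def stancuOp (η : ℝ → ℝ) {d : ℕ} (a b : Fin d → ℝ) (α β : ℝ) (n : ℕ)
    (f : EuclideanSpace ℝ (Fin d) → ℝ) (s : EuclideanSpace ℝ (Fin d)) : ℝ :=
  (∑ k ∈ Lam a b n, actM η (fun i => (n : ℝ) * s i - (k i : ℝ)) *
      f (toEuc fun i => ((k i : ℝ) + α) / ((n : ℝ) + β))) /
  ∑ k ∈ Lam a b n, actM η (fun i => (n : ℝ) * s i - (k i : ℝ))


lemma aux_act_nonneg {η : ℝ → ℝ} (hmono : Monotone η) (s : ℝ) : 0 ≤ act η s := by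
  have := hmono (show s - 1 ≤ s + 1 by linarith)
  unfold act; linarith

lemma aux_act_even {η : ℝ → ℝ} (hP1 : ∀ s : ℝ, η (-s) - 1 / 2 = -(η s - 1 / 2)) (s : ℝ) :
    act η (-s) = act η s := by
  have h1 := hP1 (s + 1)
  have h2 := hP1 (s - 1)
  unfold act
  rw [show -s + 1 = -(s - 1) by ring, show -s - 1 = -(s + 1) by ring]
  linarith

lemma aux_nonneg {η : ℝ → ℝ} (hmono : Monotone η) (hbot : Tendsto η atBot (nhds 0)) (s : ℝ) :
    0 ≤ η s := hmono.le_of_tendsto hbot s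

lemma aux_tele (η : ℝ → ℝ) (x : ℝ) (m : ℤ) (N : ℕ) :
    ∑ k ∈ Finset.Ico m (m + N), act η (x - k) =
      (η (x - m + 1) + η (x - m)) / 2 - (η (x - (m + N) + 1) + η (x - (m + N))) / 2 := by
  induction N with
  | zero => simp
  | succ N ih =>
    have : Finset.Ico m (m + ((N + 1 : ℕ) : ℤ)) = insert (m + (N : ℤ)) (Finset.Ico m (m + N)) := by
      ext k; simp; omega
    rw [this, Finset.sum_insert (by simp), ih]
    unfold act
    push_cast
    rw [show x - (m + (N + 1)) + 1 = x - (m + N) by ring,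
      show x - (m + (N + 1) : ℝ) = x - (m + N) - 1 by ring]
    ring

lemma aux_tail {η : ℝ → ℝ} (hmono : Monotone η) (hbot : Tendsto η atBot (nhds 0))
    (x R : ℝ) (S : Finset ℤ) (hS : ∀ k ∈ S, x + R ≤ k) :
    ∑ k ∈ S, act η (x - k) ≤ η (1 - R) := by
  obtain ⟨U, hU⟩ := S.bddAbove
  set m : ℤ := ⌈x + R⌉ with hm
  have hsub : S ⊆ Finset.Ico m (m + ((U + 1 - m).toNat : ℤ)) := by
    intro k hk
    have h1 : m ≤ k := Int.ceil_le.mpr (hS k hk)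
    have h2 : k ≤ U := hU hk
    simp; omega
  refine (Finset.sum_le_sum_of_subset_of_nonneg hsub
    fun _ _ _ => aux_act_nonneg hmono _).trans ?_
  rw [aux_tele]
  have hm' : x + R ≤ m := Int.le_ceil _
  have h1 := hmono (show x - m + 1 ≤ 1 - R by linarith)
  have h2 := hmono (show x - m ≤ 1 - R by linarith)
  have h3 := aux_nonneg hmono hbot (x - (m + ((U + 1 - m).toNat : ℕ)) + 1)
  have h4 := aux_nonneg hmono hbot (x - (m + ((U + 1 - m).toNat : ℕ)))
  linarith

lemma aux_tail2 {η : ℝ → ℝ} (hmono : Monotone η) (hbot : Tendsto η atBot (nhds 0))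
    (hP1 : ∀ s : ℝ, η (-s) - 1 / 2 = -(η s - 1 / 2))
    (x R : ℝ) (S : Finset ℤ) :
    ∑ k ∈ S, act η (x - k) * (if R ≤ |x - k| then 1 else 0) ≤ 2 * η (1 - R) := by
  have h1 := aux_tail hmono hbot x R (S.filter fun k : ℤ => x + R ≤ k) (by simp)
  have h2 := aux_tail hmono hbot (-x) R ((S.filter fun k : ℤ => R ≤ x - k).image fun k => -k) (by
    intro k hk
    simp only [Finset.mem_image, Finset.mem_filter] at hk
    obtain ⟨j, ⟨_, hj⟩, rfl⟩ := hk
    push_cast; linarith)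
  rw [Finset.sum_image (by intro a _ b _ h; simpa using h)] at h2
  have h3 : ∀ k : ℤ, act η (-x - ((-k : ℤ) : ℝ)) = act η (x - k) := by
    intro k
    rw [← aux_act_even hP1]; congr 1; push_cast; ring
  simp only [h3] at h2
  rw [Finset.sum_filter] at h1 h2
  have h12 := add_le_add h1 h2
  rw [← two_mul, ← Finset.sum_add_distrib] at h12
  refine le_trans ?_ h12
  apply Finset.sum_le_sum
  intro k _
  have h0 := aux_act_nonneg hmono (x - k)
  by_cases h : R ≤ |x - k|
  · rcases le_abs.mp h with h' | h'
    · simp only [h, h', if_true]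
      split_ifs <;> linarith
    · have : x + R ≤ k := by linarith
      simp only [h, this, if_true]
      split_ifs <;> linarith
  · simp only [h, if_false, mul_zero]
    split_ifs <;> linarith

lemma aux_half {η : ℝ → ℝ} (hP1 : ∀ s : ℝ, η (-s) - 1 / 2 = -(η s - 1 / 2)) : η 0 = 1 / 2 := by
  have := hP1 0
  rw [neg_zero] at this; linarith

lemma aux_gt {η : ℝ → ℝ} (htop : Tendsto η atTop (nhds 1))
    (hP1 : ∀ s : ℝ, η (-s) - 1 / 2 = -(η s - 1 / 2)) (hP2' : ConcaveOn ℝ (Set.Ici 0) η) :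
    1 / 2 < η 1 := by
  by_contra hcon
  push Not at hcon
  have h0 := aux_half hP1
  have hle : ∀ᶠ t in atTop, η t ≤ 1 / 2 := by
    filter_upwards [eventually_gt_atTop (1 : ℝ)] with t ht
    have htp : (0 : ℝ) < t := by linarith
    have hi : t⁻¹ ≤ 1 := inv_le_one_of_one_le₀ ht.le
    have hip : 0 < t⁻¹ := inv_pos.mpr htp
    have := hP2'.2 (Set.mem_Ici.mpr le_rfl) (Set.mem_Ici.mpr htp.le)
      (show 0 ≤ 1 - t⁻¹ by linarith) hip.le (by ring)
    simp only [smul_eq_mul, mul_zero, zero_add] at this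
    rw [inv_mul_cancel₀ htp.ne', h0] at this
    by_contra hh
    push Not at hh
    nlinarith
  have := le_of_tendsto htop hle
  norm_num at this

lemma aux_lower {η : ℝ → ℝ} (hmono : Monotone η)
    (hP1 : ∀ s : ℝ, η (-s) - 1 / 2 = -(η s - 1 / 2)) (x : ℝ) (hx : |x| ≤ 1) :
    (η 1 - 1 / 2) / 2 ≤ act η x := by
  obtain ⟨h1, h2⟩ := abs_le.mp hx
  have h0 := aux_half hP1
  have hm := hP1 1
  unfold act
  rcases le_total 0 x with h | h
  · have := hmono (show 1 ≤ x + 1 by linarith)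
    have := hmono (show x - 1 ≤ 0 by linarith)
    linarith
  · have := hmono (show 0 ≤ x + 1 by linarith)
    have := hmono (show x - 1 ≤ -1 by linarith)
    linarith

lemma aux_den {η : ℝ → ℝ} (hmono : Monotone η)
    (hP1 : ∀ s : ℝ, η (-s) - 1 / 2 = -(η s - 1 / 2)) (A B x : ℝ) (hAx : A ≤ x) (hxB : x ≤ B)
    (hAB : 1 ≤ B - A) :
    (η 1 - 1 / 2) / 2 ≤ ∑ k ∈ Finset.Icc ⌈A⌉ ⌊B⌋, act η (x - k) := by
  obtain ⟨k, hk, hkx⟩ : ∃ k : ℤ, k ∈ Finset.Icc ⌈A⌉ ⌊B⌋ ∧ |x - k| ≤ 1 := by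
    by_cases h : A ≤ ⌊x⌋
    · refine ⟨⌊x⌋, ?_, ?_⟩
      · rw [Finset.mem_Icc]
        exact ⟨Int.ceil_le.mpr h, Int.floor_le_floor hxB⟩
      · rw [abs_le]
        constructor <;> linarith [Int.floor_le x, Int.lt_floor_add_one x]
    · push Not at h
      refine ⟨⌊x⌋ + 1, ?_, ?_⟩
      · rw [Finset.mem_Icc, Int.ceil_le, Int.le_floor]
        push_cast
        constructor <;> linarith [Int.floor_le x, Int.lt_floor_add_one x]
      · rw [abs_le]
        push_cast
        constructor <;> linarith [Int.floor_le x, Int.lt_floor_add_one x]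
  exact (aux_lower hmono hP1 _ hkx).trans
    (Finset.single_le_sum (f := fun k : ℤ => act η (x - k))
      (fun _ _ => aux_act_nonneg hmono _) hk)

/-- Abstract weighted estimate on product index sets. -/
lemma aux_prod {d : ℕ} (t : Fin d → Finset ℤ) (g : Fin d → ℤ → ℝ) (hg : ∀ i k, 0 ≤ g i k)
    (u : Fin d → ℤ → ℝ) (hu : ∀ i k, 0 ≤ u i k) (q : ℝ) (i : Fin d)
    (hq : ∑ k ∈ t i, g i k * u i k ≤ q * ∑ k ∈ t i, g i k) :
    ∑ p ∈ Fintype.piFinset t, (∏ j, g j (p j)) * u i (p i) ≤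
      q * ∑ p ∈ Fintype.piFinset t, ∏ j, g j (p j) := by
  have h1 : ∑ p ∈ Fintype.piFinset t, (∏ j, g j (p j)) * u i (p i) =
      ∏ j, ∑ k ∈ t j, g j k * (if j = i then u i k else 1) := by
    rw [Finset.prod_univ_sum]
    apply Finset.sum_congr rfl
    intro p _
    rw [Finset.prod_mul_distrib, Finset.prod_ite_eq']
    simp
  rw [h1, ← Finset.prod_univ_sum]
  calc _ ≤ ∏ j, ((if j = i then q else 1) * ∑ k ∈ t j, g j k) := by
        apply Finset.prod_le_prod
        · intro j _
          apply Finset.sum_nonneg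
          intro k _
          apply mul_nonneg (hg _ _)
          split_ifs
          · exact hu _ _
          · exact zero_le_one
        · intro j _
          by_cases h : j = i
          · subst h; simpa using hq
          · simp [h]
    _ = _ := by
        rw [Finset.prod_mul_distrib, Finset.prod_ite_eq']; simp

lemma aux_compact {d : ℕ} (a b : Fin d → ℝ) :
    IsCompact {s : EuclideanSpace ℝ (Fin d) | ∀ i, s i ∈ Set.Icc (a i) (b i)} := by
  have h : IsCompact (Set.pi Set.univ fun i => Set.Icc (a i) (b i)) :=
    isCompact_univ_pi fun i => isCompact_Icc
  have h2 := (EuclideanSpace.equiv (Fin d) ℝ).toHomeomorph.isCompact_preimage.mpr h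
  convert h2 using 1
  ext s
  simp only [Set.mem_ofPred_eq, Set.mem_preimage, Set.mem_pi, Set.mem_univ, true_imp_iff]
  rfl

lemma aux_dist {d : ℕ} (x y : EuclideanSpace ℝ (Fin d)) (r : ℝ) (hr : 0 < r)
    (h : ∀ i, |x i - y i| ≤ r) : dist x y < (d + 1) * r := by
  rw [EuclideanSpace.dist_eq, Real.sqrt_lt' (by positivity)]
  have : ∑ i, dist (x i) (y i) ^ 2 ≤ ∑ _i : Fin d, r ^ 2 := by
    apply Finset.sum_le_sum
    intro i _
    rw [Real.dist_eq]
    exact pow_le_pow_left₀ (abs_nonneg _) (h i) 2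
  simp only [Finset.sum_const, Finset.card_univ, Fintype.card_fin, nsmul_eq_mul] at this
  refine this.trans_lt ?_
  have hd : (0 : ℝ) ≤ d := Nat.cast_nonneg d
  have : 0 < r ^ 2 := by positivity
  nlinarith [mul_nonneg hd hd, mul_nonneg (mul_nonneg hd hd) this.le, mul_nonneg hd this.le]

theorem stancuOp_tendstoUniformlyOn
    (η : ℝ → ℝ)
    (hmono : Monotone η)
    (hmeas : Measurable η)
    (hbot : Tendsto η atBot (nhds 0))
    (htop : Tendsto η atTop (nhds 1))
    (hη1 : η 1 < 1)
    (hP1 : ∀ s : ℝ, η (-s) - 1 / 2 = -(η s - 1 / 2))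
    (hP2 : ContDiff ℝ 2 η)
    (hP2' : ConcaveOn ℝ (Set.Ici 0) η)
    (hP3 : ∃ ρ : ℝ, 0 < ρ ∧ η =O[atBot] fun s : ℝ => |s| ^ (-1 - ρ))
    (d : ℕ) (hd : 1 ≤ d) (a b : Fin d → ℝ) (hab : ∀ i, a i < b i)
    (α β : ℝ) (hα : 0 ≤ α) (hαβ : α ≤ β)
    (f : EuclideanSpace ℝ (Fin d) → ℝ)
    (hfb : ∃ M : ℝ, ∀ x, |f x| ≤ M) (hfc : Continuous f) :
    TendstoUniformlyOn (fun (n : ℕ) (s : EuclideanSpace ℝ (Fin d)) => stancuOp η a b α β n f s)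
      f atTop {s : EuclideanSpace ℝ (Fin d) | ∀ i, s i ∈ Set.Icc (a i) (b i)} := by
  classical
  obtain ⟨M, hM⟩ := hfb
  have hM0 : 0 ≤ M := (abs_nonneg _).trans (hM 0)
  rw [Metric.tendstoUniformlyOn_iff]
  intro ε hε
  have huc := (aux_compact a b).uniformContinuousAt_of_continuousAt f
    (fun x _ => hfc.continuousAt) (Metric.dist_mem_uniformity (half_pos hε))
  obtain ⟨δ, hδ, hδ'⟩ := Metric.mem_uniformity_dist.mp huc
  set r : ℝ := δ / (d + 1) with hr
  have hd1 : (0 : ℝ) < d + 1 := by positivity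
  have hr0 : 0 < r := by positivity
  set c : ℝ := (η 1 - 1 / 2) / 2 with hc
  have hc0 : 0 < c := by
    have := aux_gt htop hP1 hP2'
    rw [hc]; linarith
  set B : ℝ := ∑ i, (|a i| + |b i|) with hB
  have hB0 : 0 ≤ B := Finset.sum_nonneg fun i _ => by positivity
  have hβ : 0 ≤ β := hα.trans hαβ
  have hncast : Tendsto (fun n : ℕ => (n : ℝ)) atTop atTop := tendsto_natCast_atTop_atTop
  have e1 : ∀ᶠ n : ℕ in atTop, ∀ i, 1 ≤ (n : ℝ) * b i - n * a i := by
    rw [eventually_all]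
    intro i
    have hp : 0 < b i - a i := sub_pos.mpr (hab i)
    filter_upwards [(hncast.atTop_mul_const hp).eventually_ge_atTop 1] with n hn
    linarith
  have e2 : ∀ᶠ n : ℕ in atTop, α + β * B ≤ (n : ℝ) * (r / 2) :=
    (hncast.atTop_mul_const (half_pos hr0)).eventually_ge_atTop _
  have e3 : ∀ᶠ n : ℕ in atTop,
      2 * M * (d * (2 * η (1 - (n : ℝ) * (r / 2)) / c)) < ε / 2 := by
    have t1 : Tendsto (fun n : ℕ => 1 - (n : ℝ) * (r / 2)) atTop atBot :=
      tendsto_const_nhds.add_atBot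
        (tendsto_neg_atTop_atBot.comp (hncast.atTop_mul_const (half_pos hr0)))
    have t2 := ((((hbot.comp t1).const_mul 2).div_const c).const_mul (d : ℝ)).const_mul (2 * M)
    simp only [mul_zero, zero_div] at t2
    exact t2.eventually_lt_const (half_pos hε)
  filter_upwards [e1, e2, e3, eventually_gt_atTop 0] with n h1 h2 h3 hn s hs
  have hn0 : (0 : ℝ) < n := by exact_mod_cast hn
  set R : ℝ := (n : ℝ) * (r / 2) with hR
  set g : Fin d → ℤ → ℝ := fun i k => act η ((n : ℝ) * s i - k) with hg
  set u : Fin d → ℤ → ℝ := fun i k => if R ≤ |(n : ℝ) * s i - k| then 1 else 0 with hu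
  set t : Fin d → Finset ℤ := fun i => Finset.Icc ⌈(n : ℝ) * a i⌉ ⌊(n : ℝ) * b i⌋ with ht
  have hg0 : ∀ i k, 0 ≤ g i k := fun i k => aux_act_nonneg hmono _
  have hu0 : ∀ i k, 0 ≤ u i k := fun i k => by simp only [hu]; split_ifs <;> norm_num
  set y : (Fin d → ℤ) → EuclideanSpace ℝ (Fin d) :=
    fun k => toEuc fun i => ((k i : ℝ) + α) / ((n : ℝ) + β) with hy
  have hdi : ∀ i, c ≤ ∑ k ∈ t i, g i k := fun i =>
    aux_den hmono hP1 _ _ _ (mul_le_mul_of_nonneg_left (hs i).1 hn0.le)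
      (mul_le_mul_of_nonneg_left (hs i).2 hn0.le) (h1 i)
  set D : ℝ := ∑ p ∈ Fintype.piFinset t, ∏ j, g j (p j) with hD
  have hD0 : 0 < D := by
    rw [hD, ← Finset.prod_univ_sum]
    exact Finset.prod_pos fun i _ => hc0.trans_le (hdi i)
  have hop : stancuOp η a b α β n f s =
      (∑ p ∈ Fintype.piFinset t, (∏ j, g j (p j)) * f (y p)) / D := rfl
  set q : ℝ := 2 * η (1 - R) / c with hq
  have hη0 := aux_nonneg hmono hbot (1 - R)
  have hq0 : 0 ≤ q := by positivity
  have hqi : ∀ i, ∑ p ∈ Fintype.piFinset t, (∏ j, g j (p j)) * u i (p i) ≤ q * D := by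
    intro i
    apply aux_prod t g hg0 u hu0 q i
    refine (aux_tail2 hmono hbot hP1 _ R _).trans ?_
    calc 2 * η (1 - R) = q * c := by rw [hq]; field_simp
      _ ≤ _ := mul_le_mul_of_nonneg_left (hdi i) hq0
  have hpt : ∀ p, |f (y p) - f s| ≤ ε / 2 + 2 * M * ∑ i, u i (p i) := by
    intro p
    by_cases hbad : ∃ i, R ≤ |(n : ℝ) * s i - p i|
    · obtain ⟨i, hi⟩ := hbad
      have hone : 1 ≤ ∑ i, u i (p i) := by
        have : u i (p i) = 1 := by simp only [hu]; rw [if_pos hi]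
        rw [← this]
        exact Finset.single_le_sum (f := fun i => u i (p i)) (fun j _ => hu0 j _)
          (Finset.mem_univ i)
      have h4 : |f (y p) - f s| ≤ 2 * M :=
        (abs_sub _ _).trans (by linarith [hM (y p), hM s])
      nlinarith
    · push Not at hbad
      have hnn : 0 ≤ ∑ i, u i (p i) := Finset.sum_nonneg fun i _ => hu0 i _
      have hdist : dist s (y p) < δ := by
        have := aux_dist s (y p) r hr0 (by
          intro i
          have hyi : y p i = ((p i : ℝ) + α) / ((n : ℝ) + β) := rfl
          have hnb : 0 < (n : ℝ) + β := by linarith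
          have hsB : |s i| ≤ B := by
            have hs1 : |s i| ≤ |a i| + |b i| := by
              rw [abs_le]
              constructor
              · linarith [(hs i).1, neg_abs_le (a i), abs_nonneg (b i)]
              · linarith [(hs i).2, le_abs_self (b i), abs_nonneg (a i)]
            exact hs1.trans (Finset.single_le_sum (f := fun i => |a i| + |b i|)
              (fun j _ => by positivity) (Finset.mem_univ i))
          have heq : s i - y p i = ((n * s i - p i) + (β * s i - α)) / ((n : ℝ) + β) := by
            rw [hyi]; field_simp; ring
          rw [heq, abs_div, abs_of_pos hnb, div_le_iff₀ hnb]
          have hb := abs_lt.mp (hbad i)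
          have hs2 := abs_le.mp hsB
          have k1 : β * s i ≤ β * B := mul_le_mul_of_nonneg_left hs2.2 hβ
          have k2 : β * (-B) ≤ β * s i := mul_le_mul_of_nonneg_left hs2.1 hβ
          have k3 : 0 ≤ r * β := by positivity
          rw [abs_le]
          constructor <;> nlinarith)
        rwa [hr, mul_div_cancel₀ _ hd1.ne'] at this
      have h5 := hδ' hdist hs
      simp only [Set.mem_ofPred_eq] at h5
      rw [dist_comm, Real.dist_eq] at h5
      have : 0 ≤ 2 * M * ∑ i, u i (p i) := by positivity
      linarith
  rw [dist_comm, Real.dist_eq, hop]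
  have hsub : (∑ p ∈ Fintype.piFinset t, (∏ j, g j (p j)) * f (y p)) / D - f s =
      (∑ p ∈ Fintype.piFinset t, (∏ j, g j (p j)) * (f (y p) - f s)) / D := by
    simp only [mul_sub, Finset.sum_sub_distrib, ← Finset.sum_mul]
    rw [← hD]; field_simp
  rw [hsub, abs_div, abs_of_pos hD0, div_lt_iff₀ hD0]
  calc |∑ p ∈ Fintype.piFinset t, (∏ j, g j (p j)) * (f (y p) - f s)|
      ≤ ∑ p ∈ Fintype.piFinset t, (∏ j, g j (p j)) * (ε / 2 + 2 * M * ∑ i, u i (p i)) := by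
        refine (Finset.abs_sum_le_sum_abs _ _).trans (Finset.sum_le_sum fun p _ => ?_)
        have hw : 0 ≤ ∏ j, g j (p j) := Finset.prod_nonneg fun j _ => hg0 j _
        rw [abs_mul, abs_of_nonneg hw]
        exact mul_le_mul_of_nonneg_left (hpt p) hw
    _ = ε / 2 * D + 2 * M * ∑ i, ∑ p ∈ Fintype.piFinset t, (∏ j, g j (p j)) * u i (p i) := by
        rw [Finset.sum_comm, hD, Finset.mul_sum, Finset.mul_sum, ← Finset.sum_add_distrib]
        apply Finset.sum_congr rfl
        intro p _
        rw [← Finset.mul_sum]; ring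
    _ ≤ ε / 2 * D + 2 * M * ∑ _i : Fin d, q * D := by
        have := Finset.sum_le_sum fun i (_ : i ∈ Finset.univ) => hqi i
        have hMM : 0 ≤ 2 * M := by linarith
        linarith [mul_le_mul_of_nonneg_left this hMM]
    _ = (ε / 2 + 2 * M * (d * q)) * D := by
        simp only [Finset.sum_const, Finset.card_univ, Fintype.card_fin, nsmul_eq_mul]; ring
    _ < ε * D := by
        apply mul_lt_mul_of_pos_right _ hD0
        linarith
end
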